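/- arXiv:2312.11893 — 2 statements merged into one kernel-verified Lean document; each statement's English description precedes it below -/
import Mathlib

section
/- For every Hurst parameter H in (1/2,1) and all reals 0 < s ≤ t, the kernel Z_H satisfies the reproducing identity ∫₀^s Z_H(t,u) Z_H(s,u) du = (1/2)(t^{2H} + s^{2H} - (t-s)^{2H}); consequently the process B^H_t = ∫₀^t Z_H(t,s) dB_s defined from a standard Brownian motion B has the covariance of fractional Brownian motion. -/
open MeasureTheory Real Set intervalIntegral

/-- The normalizing constant `κ_H`. -/
noncomputable def kappaH (H : ℝ) : ℝ :=
  Real.sqrt (2 * H * Real.Gamma (3/2 - H) / (Real.Gamma (H + 1/2) * Real.Gamma (2 - 2*H)))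

/-- The kernel `Z_H(t,s)` of the moving-average representation of fractional
Brownian motion with Hurst parameter `H`. -/
noncomputable def ZH (H t s : ℝ) : ℝ :=
  kappaH H * ((t / s) ^ (H - 1/2) * (t - s) ^ (H - 1/2)
    - (H - 1/2) * s ^ ((1:ℝ)/2 - H) * ∫ u in s..t, u ^ (H - 3/2) * (u - s) ^ (H - 1/2))

open scoped ENNReal

/-- Nonnegative kernel whose primitive in `x` is (up to a constant) `Z_H`. -/
noncomputable def gK (a u x : ℝ) : ℝ≥0∞ :=
  if 0 < u ∧ u < x then ENNReal.ofReal (u ^ (-a) * (x - u) ^ (a - 1) * x ^ a) else 0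

lemma gK_measurable (a : ℝ) : Measurable (fun p : ℝ × ℝ => gK a p.1 p.2) := by
  unfold gK
  refine Measurable.ite ?_ (by fun_prop) (by fun_prop)
  exact (measurableSet_lt measurable_const measurable_fst).inter
    (measurableSet_lt measurable_fst measurable_snd)

lemma intervalIntegrable_shift (a u t : ℝ) (ha : 0 < a) :
    IntervalIntegrable (fun x => (x - u) ^ (a - 1)) volume u t := by
  have h := (intervalIntegral.intervalIntegrable_rpow' (a := 0) (b := t - u)
    (r := a - 1) (by linarith)).comp_sub_right u
  simpa using h

lemma ZH_ibp (H : ℝ) (hH : H ∈ Set.Ioo (1/2 : ℝ) 1) (u t : ℝ) (hu : 0 < u) (hut : u ≤ t) :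
    ZH H t u = kappaH H * (H - 1/2) * (u ^ (-(H - 1/2)) *
      ∫ x in u..t, (x - u) ^ ((H - 1/2) - 1) * x ^ (H - 1/2)) := by
  obtain ⟨a, rfl⟩ : ∃ a, H = a + 1/2 := ⟨H - 1/2, by ring⟩
  have ha : 0 < a := by have := hH.1; linarith
  have e1 : a + 1/2 - 1/2 = a := by ring
  have e2 : (1:ℝ)/2 - (a + 1/2) = -a := by ring
  have e3 : a + 1/2 - 3/2 = a - 1 := by ring
  unfold ZH
  rw [e1, e2, e3]
  have hI1 : IntervalIntegrable (fun x => x ^ (a-1) * (x - u) ^ a) volume u t := by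
    apply ContinuousOn.intervalIntegrable
    rw [uIcc_of_le hut]
    apply ContinuousOn.mul
    · exact continuousOn_id.rpow_const (fun x hx => Or.inl (by simp only [id]; linarith [hx.1]))
    · exact (continuousOn_id.sub continuousOn_const).rpow_const (fun x hx => Or.inr ha.le)
  have hI2 : IntervalIntegrable (fun x => (x - u) ^ (a - 1) * x ^ a) volume u t := by
    apply (intervalIntegrable_shift a u t ha).mul_continuousOn
    exact continuousOn_id.rpow_const (fun x hx => Or.inr ha.le)
  have key := intervalIntegral.integral_eq_sub_of_hasDerivAt_of_le hut
    (f := fun x => x ^ a * (x - u) ^ a)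
    (f' := fun x => a * (x ^ (a-1) * (x - u) ^ a) + a * ((x - u) ^ (a - 1) * x ^ a))
    (by
      apply ContinuousOn.mul
      · exact continuousOn_id.rpow_const (fun x hx => Or.inr ha.le)
      · exact (continuousOn_id.sub continuousOn_const).rpow_const (fun x hx => Or.inr ha.le))
    (by
      intro x hx
      have h1 := Real.hasDerivAt_rpow_const (x := x) (p := a) (Or.inl (by linarith [hx.1]))
      have h2 := ((hasDerivAt_id x).sub_const u).rpow_const (p := a)
        (Or.inl (by simp only [id]; linarith [hx.1]))
      refine (h1.mul h2).congr_deriv ?_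
      simp only [id]; ring)
    ((hI1.const_mul a).add (hI2.const_mul a))
  rw [intervalIntegral.integral_add (hI1.const_mul a) (hI2.const_mul a),
    intervalIntegral.integral_const_mul, intervalIntegral.integral_const_mul, sub_self,
    Real.zero_rpow ha.ne', mul_zero, sub_zero] at key
  have e4 : (t / u) ^ a = t ^ a * u ^ (-a) := by
    rw [Real.div_rpow (by linarith) hu.le, Real.rpow_neg hu.le]; rfl
  rw [e4]
  linear_combination (- kappaH (a + 1/2) * u ^ (-a)) * key

lemma kappaH_nonneg (H : ℝ) : 0 ≤ kappaH H := Real.sqrt_nonneg _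

lemma ZH_lint (H : ℝ) (hH : H ∈ Set.Ioo (1/2 : ℝ) 1) (u t : ℝ) (hu : 0 < u) (hut : u ≤ t) :
    0 ≤ ZH H t u ∧ ENNReal.ofReal (ZH H t u) =
      ENNReal.ofReal (kappaH H * (H - 1/2)) * ∫⁻ x in Ioo 0 t, gK (H - 1/2) u x := by
  have ha : 0 < H - 1/2 := by have := hH.1; linarith
  rw [ZH_ibp H hH u t hu hut]
  generalize H - 1/2 = a at *
  have hk : 0 ≤ kappaH H * a := mul_nonneg (kappaH_nonneg H) ha.le
  have hI2 : IntervalIntegrable (fun x => (x - u) ^ (a - 1) * x ^ a) volume u t := by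
    apply (intervalIntegrable_shift a u t ha).mul_continuousOn
    exact continuousOn_id.rpow_const (fun x hx => Or.inr ha.le)
  have hnn : ∀ x ∈ Ioo u t, 0 ≤ u ^ (-a) * ((x - u) ^ (a - 1) * x ^ a) := by
    intro x hx
    have : 0 < x - u := by linarith [hx.1]
    have : 0 < x := by linarith [hx.1]
    positivity
  rw [← intervalIntegral.integral_const_mul, intervalIntegral.integral_of_le hut,
    integral_Ioc_eq_integral_Ioo]
  refine ⟨mul_nonneg hk (setIntegral_nonneg measurableSet_Ioo hnn), ?_⟩
  rw [ENNReal.ofReal_mul hk, ofReal_integral_eq_lintegral_ofReal]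
  · congr 1
    rw [← lintegral_indicator measurableSet_Ioo, ← lintegral_indicator measurableSet_Ioo]
    congr 1
    ext x
    unfold gK
    by_cases h1 : x ∈ Ioo u t
    · rw [indicator_of_mem h1, indicator_of_mem (show x ∈ Ioo 0 t from ⟨hu.trans h1.1, h1.2⟩), if_pos ⟨hu, h1.1⟩]
      ring_nf
    · rw [indicator_of_notMem h1]
      by_cases h2 : x ∈ Ioo 0 t
      · rw [indicator_of_mem h2, if_neg]
        exact fun h => h1 ⟨h.2, h2.2⟩
      · rw [indicator_of_notMem h2]
  · have := (hI2.const_mul (u ^ (-a)))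
    rw [intervalIntegrable_iff_integrableOn_Ioo_of_le hut] at this
    exact this
  · exact (ae_restrict_iff' measurableSet_Ioo).2 (Filter.Eventually.of_forall hnn)

lemma beta_lint (p q : ℝ) (hp : 0 < p) (hq : 0 < q) :
    ∫⁻ w in Ioo (0:ℝ) 1, ENNReal.ofReal (w ^ (p - 1) * (1 - w) ^ (q - 1))
      = ENNReal.ofReal (ProbabilityTheory.beta p q) := by
  have hb := ProbabilityTheory.beta_pos hp hq
  have h := ProbabilityTheory.lintegral_betaPDF_eq_one hp hq
  rw [ProbabilityTheory.lintegral_betaPDF] at h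
  have h2 : ∀ w : ℝ, ENNReal.ofReal (1 / ProbabilityTheory.beta p q * w ^ (p - 1) * (1 - w) ^ (q - 1))
     = ENNReal.ofReal (1 / ProbabilityTheory.beta p q) *
       ENNReal.ofReal (w ^ (p - 1) * (1 - w) ^ (q - 1)) := by
    intro w
    rw [← ENNReal.ofReal_mul (by positivity), mul_assoc]
  simp_rw [h2] at h
  rw [lintegral_const_mul' _ _ ENNReal.ofReal_ne_top] at h
  have h3 : ENNReal.ofReal (ProbabilityTheory.beta p q) *
      ENNReal.ofReal (1 / ProbabilityTheory.beta p q) = 1 := by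
    rw [← ENNReal.ofReal_mul hb.le, mul_one_div_cancel hb.ne', ENNReal.ofReal_one]
  calc _ = (ENNReal.ofReal (ProbabilityTheory.beta p q) *
      ENNReal.ofReal (1 / ProbabilityTheory.beta p q)) * _ := by rw [h3, one_mul]
    _ = _ := by rw [mul_assoc, h, mul_one]

lemma inner_lt (a : ℝ) (ha : 0 < a) (ha2 : a < 1/2) (x y : ℝ) (hy : 0 < y) (hyx : y < x) :
    ∫⁻ u, gK a u x * gK a u y =
      ENNReal.ofReal (ProbabilityTheory.beta (1 - 2*a) a * |x - y| ^ (2*a - 1)) := by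
  have hx : 0 < x := hy.trans hyx
  have hd : 0 < x - y := by linarith
  have h1 : ∀ u, gK a u x * gK a u y = (Ioo 0 y).indicator (fun u => 
      ENNReal.ofReal (u ^ (-a) * (x - u) ^ (a - 1) * x ^ a * 
        (u ^ (-a) * (y - u) ^ (a - 1) * y ^ a))) u := by
    intro u
    unfold gK
    by_cases hu : u ∈ Ioo 0 y
    · have : 0 < u := hu.1
      have h2 : 0 < x - u := by linarith [hu.2]
      rw [indicator_of_mem hu, if_pos ⟨hu.1, hu.2.trans hyx⟩, if_pos (c := 0 < u ∧ u < y) hu,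
        ← ENNReal.ofReal_mul (by positivity)]
    · rw [indicator_of_notMem hu, if_neg (c := 0 < u ∧ u < y) hu, mul_zero]
  simp_rw [h1]
  rw [lintegral_indicator measurableSet_Ioo]
  set f : ℝ → ℝ := fun u => u * (x - y) / (y * (x - u)) with hf
  set f' : ℝ → ℝ := fun u => x * (x - y) / (y * (x - u) ^ 2) with hf'
  have himg : Set.image f (Ioo 0 y) = Ioo 0 1 := by
    ext w
    simp only [mem_image, mem_Ioo, hf]
    constructor
    · rintro ⟨u, ⟨h0, h2⟩, rfl⟩
      have h3 : 0 < x - u := by linarith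
      refine ⟨by positivity, ?_⟩
      rw [div_lt_one (by positivity)]
      nlinarith
    · rintro ⟨h0, h2⟩
      have h3 : 0 < (x - y) + w * y := by positivity
      have h5 : x - w * x * y / ((x - y) + w * y) = x * (x - y) / ((x - y) + w * y) := by
        field_simp; ring
      refine ⟨w * x * y / ((x - y) + w * y), ⟨by positivity, ?_⟩, ?_⟩
      · rw [div_lt_iff₀ h3]
        have : 0 < y * ((1 - w) * (x - y)) := by
          have : 0 < 1 - w := by linarith
          positivity
        nlinarith
      · rw [h5]; field_simp
  have hder : ∀ u ∈ Ioo 0 y, HasDerivWithinAt f (f' u) (Ioo 0 y) u := by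
    intro u hu
    have h3 : 0 < x - u := by linarith [hu.2]
    have d := (((hasDerivAt_id u).mul_const (x - y)).div
      (((hasDerivAt_id u).const_sub x).const_mul y) (by simp only [id]; positivity)).hasDerivWithinAt (s := Ioo 0 y)
    refine d.congr_deriv ?_
    simp only [hf', id]
    field_simp
    ring
  have hinj : InjOn f (Ioo 0 y) := by
    intro u hu v hv huv
    have h3 : 0 < x - u := by linarith [hu.2]
    have h4 : 0 < x - v := by linarith [hv.2]
    simp only [hf] at huv
    rw [div_eq_div_iff (by positivity) (by positivity)] at huv
    have : (x - y) * y * x * (u - v) = 0 := by linear_combination huv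
    have h5 : (x - y) * y * x ≠ 0 := by positivity
    have := (mul_eq_zero.1 this).resolve_left h5
    linarith
  have hcv := lintegral_image_eq_lintegral_abs_deriv_mul measurableSet_Ioo hder hinj
    (fun w => ENNReal.ofReal (w ^ ((1 - 2*a) - 1) * (1 - w) ^ (a - 1)))
  rw [himg, beta_lint _ _ (by linarith) ha] at hcv
  rw [abs_of_pos hd, mul_comm, ENNReal.ofReal_mul (by positivity), hcv,
    ← lintegral_const_mul' _ _ ENNReal.ofReal_ne_top]
  refine setLIntegral_congr_fun measurableSet_Ioo ?_
  intro u hu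
  have hu0 : 0 < u := hu.1
  have h3 : 0 < x - u := by linarith [hu.2]
  have h4 : 0 < y - u := by linarith [hu.2]
  have hf1 : 1 - f u = x * (y - u) / (y * (x - u)) := by
    simp only [hf]; field_simp; ring
  have hf'pos : 0 < f' u := by simp only [hf']; positivity
  simp only
  rw [abs_of_pos hf'pos, ← ENNReal.ofReal_mul hf'pos.le, ← ENNReal.ofReal_mul (by positivity), hf1]
  congr 1
  simp only [hf, hf']
  have L : ∀ z : ℝ, 0 < z → ∀ r : ℝ, z ^ r = Real.exp (Real.log z * r) :=
    fun z hz r => Real.rpow_def_of_pos hz r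
  have E : ∀ z : ℝ, 0 < z → z = Real.exp (Real.log z) := fun z hz => (Real.exp_log hz).symm
  rw [Real.div_rpow (by positivity) (by positivity), Real.div_rpow (by positivity) (by positivity),
    Real.mul_rpow (by positivity) (by positivity), Real.mul_rpow (by positivity) (by positivity),
    Real.mul_rpow (by positivity) (by positivity), Real.mul_rpow (by positivity) (by positivity)]
  have : x * (x - y) / (y * (x - u) ^ 2) = x ^ (1:ℝ) * (x-y) ^ (1:ℝ) / (y ^ (1:ℝ) * (x - u) ^ (2:ℝ)) := by
    norm_num
  rw [this]
  simp only [L u hu0, L _ h3, L _ h4, L x hx, L y hy, L _ hd]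
  simp only [← Real.exp_add, ← Real.exp_sub]
  congr 1
  ring

lemma inner_ne (a : ℝ) (ha : 0 < a) (ha2 : a < 1/2) (x y : ℝ) (hy : 0 < y) (hx : 0 < x)
    (hyx : x ≠ y) :
    ∫⁻ u, gK a u x * gK a u y =
      ENNReal.ofReal (ProbabilityTheory.beta (1 - 2*a) a * |x - y| ^ (2*a - 1)) := by
  rcases lt_or_gt_of_ne hyx with h | h
  · rw [abs_sub_comm, ← inner_lt a ha ha2 y x hx h]
    simp_rw [mul_comm]
  · exact inner_lt a ha ha2 x y hy h

lemma abs_int (b : ℝ) (hb : 0 < b) (y t : ℝ) (hy : 0 < y) (hyt : y < t) :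
    ∫⁻ x in Ioo 0 t, ENNReal.ofReal (|x - y| ^ (b - 1)) =
      ENNReal.ofReal ((y ^ b + (t - y) ^ b) / b) := by
  have i1 : IntervalIntegrable (fun x => |x - y| ^ (b - 1)) volume 0 y := by
    have h := (intervalIntegral.intervalIntegrable_rpow' (a := y) (b := 0)
      (r := b - 1) (by linarith)).comp_sub_left y
    simp only [sub_self, sub_zero] at h
    refine h.congr_ae ?_
    refine (ae_restrict_iff' measurableSet_uIoc).2 (Filter.Eventually.of_forall ?_)
    intro x hx
    rw [uIoc_of_le hy.le] at hx
    simp only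
    rw [abs_sub_comm, abs_of_nonneg (by linarith [hx.2])]
  have i2 : IntervalIntegrable (fun x => |x - y| ^ (b - 1)) volume y t := by
    refine (intervalIntegrable_shift b y t hb).congr_ae ?_
    refine (ae_restrict_iff' measurableSet_uIoc).2 (Filter.Eventually.of_forall ?_)
    intro x hx
    rw [uIoc_of_le hyt.le] at hx
    simp only
    rw [abs_of_nonneg (by linarith [hx.1])]
  have i := i1.trans i2
  rw [intervalIntegrable_iff_integrableOn_Ioo_of_le (hy.trans hyt).le] at i
  rw [← ofReal_integral_eq_lintegral_ofReal i
    (Filter.Eventually.of_forall (fun x => by simp only [Pi.zero_apply]; positivity))]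
  congr 1
  rw [← integral_Ioc_eq_integral_Ioo, ← intervalIntegral.integral_of_le (hy.trans hyt).le,
    ← intervalIntegral.integral_add_adjacent_intervals i1 i2]
  have v1 : ∫ x in (0:ℝ)..y, |x - y| ^ (b - 1) = y ^ b / b := by
    have : ∫ x in (0:ℝ)..y, |x - y| ^ (b - 1) = ∫ x in (0:ℝ)..y, (y - x) ^ (b - 1) := by
      apply intervalIntegral.integral_congr
      intro x hx
      rw [uIcc_of_le hy.le] at hx
      simp only
      rw [abs_sub_comm, abs_of_nonneg (by linarith [hx.2])]
    rw [this, intervalIntegral.integral_comp_sub_left (fun x => x ^ (b - 1)),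
      integral_rpow (Or.inl (by linarith))]
    simp [Real.zero_rpow hb.ne']
  have v2 : ∫ x in y..t, |x - y| ^ (b - 1) = (t - y) ^ b / b := by
    have : ∫ x in y..t, |x - y| ^ (b - 1) = ∫ x in y..t, (x - y) ^ (b - 1) := by
      apply intervalIntegral.integral_congr
      intro x hx
      rw [uIcc_of_le hyt.le] at hx
      simp only
      rw [abs_of_nonneg (by linarith [hx.1])]
    rw [this, intervalIntegral.integral_comp_sub_right (fun x => x ^ (b - 1)),
      integral_rpow (Or.inl (by linarith))]
    simp [Real.zero_rpow hb.ne']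
  rw [v1, v2]; ring

lemma abs_int2 (b : ℝ) (hb : 0 < b) (s t : ℝ) (hs : 0 < s) (hst : s ≤ t) :
    ∫⁻ y in Ioo 0 s, ∫⁻ x in Ioo 0 t, ENNReal.ofReal (|x - y| ^ (b - 1)) =
      ENNReal.ofReal ((t ^ (b+1) + s ^ (b+1) - (t - s) ^ (b+1)) / (b * (b + 1))) := by
  have h1 : ∫⁻ y in Ioo 0 s, ∫⁻ x in Ioo 0 t, ENNReal.ofReal (|x - y| ^ (b - 1)) =
      ∫⁻ y in Ioo 0 s, ENNReal.ofReal ((y ^ b + (t - y) ^ b) / b) :=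
    setLIntegral_congr_fun measurableSet_Ioo
      (fun y hy => abs_int b hb y t hy.1 (hy.2.trans_le hst))
  have c1 : Continuous (fun y : ℝ => y ^ b) := continuous_id.rpow_const (fun _ => Or.inr hb.le)
  have c2 : Continuous (fun y : ℝ => (t - y) ^ b) :=
    (continuous_const.sub continuous_id).rpow_const (fun _ => Or.inr hb.le)
  have c : Continuous (fun y : ℝ => (y ^ b + (t - y) ^ b) / b) := (c1.add c2).div_const b
  have i := c.intervalIntegrable (μ := volume) 0 s
  rw [intervalIntegrable_iff_integrableOn_Ioo_of_le hs.le] at i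
  rw [h1, ← ofReal_integral_eq_lintegral_ofReal i]
  · congr 1
    rw [← integral_Ioc_eq_integral_Ioo, ← intervalIntegral.integral_of_le hs.le,
      intervalIntegral.integral_div,
      intervalIntegral.integral_add (c1.intervalIntegrable _ _) (c2.intervalIntegrable _ _),
      intervalIntegral.integral_comp_sub_left (fun x => x ^ b),
      integral_rpow (Or.inl (by linarith)), integral_rpow (Or.inl (by linarith)),
      Real.zero_rpow (by linarith), sub_zero, sub_zero]
    field_simp
    ring
  · refine (ae_restrict_iff' measurableSet_Ioo).2 (Filter.Eventually.of_forall ?_)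
    intro y hy
    have h2 : 0 < y := hy.1
    have h3 : 0 < t - y := by linarith [hy.2]
    simp only [Pi.zero_apply]
    positivity

lemma const_eq (H : ℝ) (hH : H ∈ Set.Ioo (1/2 : ℝ) 1) :
    (kappaH H * (H - 1/2)) * (kappaH H * (H - 1/2)) *
      ProbabilityTheory.beta (1 - 2 * (H - 1/2)) (H - 1/2) = H * (2 * H - 1) := by
  obtain ⟨h1, h2⟩ := hH
  have g1 : 0 < Real.Gamma (3/2 - H) := Real.Gamma_pos_of_pos (by linarith)
  have g2 : 0 < Real.Gamma (H - 1/2) := Real.Gamma_pos_of_pos (by linarith)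
  have g3 : 0 < Real.Gamma (2 - 2*H) := Real.Gamma_pos_of_pos (by linarith)
  have g4 : Real.Gamma (H + 1/2) = (H - 1/2) * Real.Gamma (H - 1/2) := by
    rw [← Real.Gamma_add_one (by linarith)]; congr 1; ring
  have ha : 0 < H - 1/2 := by linarith
  have hH0 : 0 < H := by linarith
  have hk : kappaH H * kappaH H =
      2 * H * Real.Gamma (3/2 - H) / (Real.Gamma (H + 1/2) * Real.Gamma (2 - 2*H)) := by
    unfold kappaH
    rw [Real.mul_self_sqrt]
    rw [g4]; positivity
  rw [g4] at hk
  have e1 : 1 - 2 * (H - 1/2) = 2 - 2 * H := by ring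
  have e2 : 2 - 2 * H + (H - 1/2) = 3/2 - H := by ring
  unfold ProbabilityTheory.beta
  rw [e1, e2]
  calc _ = (kappaH H * kappaH H) * (H - 1/2)^2 * (Real.Gamma (2 - 2*H) * Real.Gamma (H - 1/2) / Real.Gamma (3/2 - H)) := by ring
    _ = _ := by
      rw [hk]
      generalize Real.Gamma (3/2 - H) = A at *
      generalize Real.Gamma (H - 1/2) = B at *
      generalize Real.Gamma (2 - 2*H) = C at *
      have : H - 1/2 ≠ 0 := ha.ne'
      have e : 2 * H - 1 = 2 * (H - 1/2) := by ring
      rw [e]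
      generalize H - 1/2 = D at *
      field_simp

/-- The reproducing identity for the kernel `Z_H`: for `1/2 < H < 1` and `0 < s ≤ t`,
`∫₀^s Z_H(t,u) Z_H(s,u) du = (1/2)(t^{2H} + s^{2H} - (t-s)^{2H})`.  Consequently the
process `B^H_t = ∫₀^t Z_H(t,s) dB_s` has the covariance of fractional Brownian motion. -/
theorem ZH_reproducing_identity (H : ℝ) (hH : H ∈ Set.Ioo (1/2 : ℝ) 1)
    (s t : ℝ) (hs : 0 < s) (hst : s ≤ t) :
    ∫ u in (0:ℝ)..s, ZH H t u * ZH H s u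
      = (1/2) * (t ^ (2*H) + s ^ (2*H) - (t - s) ^ (2*H)) := by
  have hconst := const_eq H hH
  have hZ := ZH_lint H hH
  obtain ⟨hH1, hH2⟩ := hH
  have ha : 0 < H - 1/2 := by linarith
  have hb : 0 < 2 * (H - 1/2) := by linarith
  have hfin := abs_int2 (2 * (H - 1/2)) hb s t hs hst
  have hinner := inner_ne (H - 1/2) ha (by linarith)
  have hbeta := ProbabilityTheory.beta_pos (α := 1 - 2 * (H - 1/2)) (β := H - 1/2)
    (by linarith) ha
  have e1 : 2 * (H - 1/2) + 1 = 2 * H := by ring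
  have e2 : 2 * (H - 1/2) = 2 * H - 1 := by ring
  rw [e1] at hfin
  have hk : 0 ≤ kappaH H * (H - 1/2) := mul_nonneg (kappaH_nonneg H) ha.le
  generalize hadef : H - 1/2 = a at *
  generalize kappaH H * a = c at *
  have hmeas := gK_measurable a
  have hmI : ∀ r : ℝ, Measurable (fun u => ∫⁻ x in Ioo 0 r, gK a u x) := fun r =>
    Measurable.lintegral_prod_right' (ν := volume.restrict (Ioo 0 r)) hmeas
  have hstep : ∫⁻ u in Ioc 0 s, ENNReal.ofReal (ZH H t u * ZH H s u) =
      ENNReal.ofReal (H * (2 * H - 1) *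
        ((t ^ (2*H) + s ^ (2*H) - (t - s) ^ (2*H)) / (2 * a * (2 * H)))) := by
    calc _ = ∫⁻ u in Ioc 0 s, ENNReal.ofReal (c * c) *
            ((∫⁻ x in Ioo 0 t, gK a u x) * ∫⁻ y in Ioo 0 s, gK a u y) := by
          refine setLIntegral_congr_fun measurableSet_Ioc ?_
          intro u hu
          obtain ⟨p1, p2⟩ := hZ u t hu.1 (hu.2.trans hst)
          obtain ⟨q1, q2⟩ := hZ u s hu.1 hu.2
          simp only
          rw [ENNReal.ofReal_mul p1, p2, q2, ENNReal.ofReal_mul hk]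
          ring
      _ = ENNReal.ofReal (c * c) * ∫⁻ u in Ioc 0 s, 
            ((∫⁻ x in Ioo 0 t, gK a u x) * ∫⁻ y in Ioo 0 s, gK a u y) :=
          lintegral_const_mul' _ _ ENNReal.ofReal_ne_top
      _ = ENNReal.ofReal (c * c) * ∫⁻ u, 
            ((∫⁻ x in Ioo 0 t, gK a u x) * ∫⁻ y in Ioo 0 s, gK a u y) := by
          congr 1
          rw [← lintegral_indicator measurableSet_Ioc]
          congr 1
          ext u
          by_cases hu : u ∈ Ioc 0 s
          · rw [indicator_of_mem hu]
          · rw [indicator_of_notMem hu]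
            have : ∫⁻ y in Ioo 0 s, gK a u y = 0 := by
              refine setLIntegral_eq_zero measurableSet_Ioo ?_
              intro y hy
              unfold gK
              exact if_neg (fun h => hu ⟨h.1, (h.2.trans hy.2).le⟩)
            rw [this, mul_zero]
      _ = ENNReal.ofReal (c * c) * ∫⁻ u, ∫⁻ y in Ioo 0 s, ∫⁻ x in Ioo 0 t,
            gK a u x * gK a u y := by
          congr 1
          refine lintegral_congr fun u => ?_
          have hu : Measurable (gK a u) := hmeas.comp measurable_prodMk_left
          rw [mul_comm, ← lintegral_lintegral_mul hu.aemeasurable hu.aemeasurable]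
          simp_rw [mul_comm]
      _ = ENNReal.ofReal (c * c) * ∫⁻ y in Ioo 0 s, ∫⁻ u, ∫⁻ x in Ioo 0 t,
            gK a u x * gK a u y := by
          congr 1
          refine lintegral_lintegral_swap (Measurable.aemeasurable ?_)
          refine Measurable.lintegral_prod_right' (ν := volume.restrict (Ioo 0 t))
            (f := fun q : (ℝ × ℝ) × ℝ => gK a q.1.1 q.2 * gK a q.1.1 q.1.2) ?_
          exact (hmeas.comp (g := fun p : ℝ × ℝ => gK a p.1 p.2)
              (f := fun q : (ℝ × ℝ) × ℝ => (q.1.1, q.2)) (by fun_prop)).mul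
            (hmeas.comp (g := fun p : ℝ × ℝ => gK a p.1 p.2)
              (f := fun q : (ℝ × ℝ) × ℝ => (q.1.1, q.1.2)) (by fun_prop))
      _ = ENNReal.ofReal (c * c) * ∫⁻ y in Ioo 0 s, ∫⁻ x in Ioo 0 t, ∫⁻ u,
            gK a u x * gK a u y := by
          congr 1
          refine lintegral_congr fun y => ?_
          refine lintegral_lintegral_swap (Measurable.aemeasurable ?_)
          exact (hmeas.comp (g := fun p : ℝ × ℝ => gK a p.1 p.2)
              (f := fun q : ℝ × ℝ => (q.1, q.2)) (by fun_prop)).mul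
            (hmeas.comp (g := fun p : ℝ × ℝ => gK a p.1 p.2)
              (f := fun q : ℝ × ℝ => (q.1, y)) (by fun_prop))
      _ = ENNReal.ofReal (c * c) * ∫⁻ y in Ioo 0 s, ∫⁻ x in Ioo 0 t,
            ENNReal.ofReal (ProbabilityTheory.beta (1 - 2*a) a) *
              ENNReal.ofReal (|x - y| ^ (2*a - 1)) := by
          congr 1
          refine setLIntegral_congr_fun measurableSet_Ioo ?_
          intro y hy
          refine setLIntegral_congr_fun_ae measurableSet_Ioo ?_
          have hne : ∀ᵐ x : ℝ, x ≠ y := by simp [ae_iff]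
          filter_upwards [hne] with x hx hxt
          rw [hinner x y hy.1 hxt.1 hx, ENNReal.ofReal_mul hbeta.le]
      _ = _ := by
          simp_rw [lintegral_const_mul' _ _ ENNReal.ofReal_ne_top]
          rw [hfin, ← mul_assoc, ← ENNReal.ofReal_mul (mul_nonneg hk hk), hconst,
            ← ENNReal.ofReal_mul (by nlinarith)]
  have hmZ : ∀ r, s ≤ r → ∀ u ∈ Ioc 0 s, 
      ZH H r u = (ENNReal.ofReal c * ∫⁻ x in Ioo 0 r, gK a u x).toReal := by
    intro r hr u hu
    obtain ⟨p1, p2⟩ := hZ u r hu.1 (hu.2.trans hr)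
    rw [← p2, ENNReal.toReal_ofReal p1]
  rw [intervalIntegral.integral_of_le hs.le, integral_eq_lintegral_of_nonneg_ae, hstep,
    ENNReal.toReal_ofReal]
  · rw [e2]
    have : 2 * H - 1 ≠ 0 := by linarith
    have : H ≠ 0 := by linarith
    generalize t ^ (2*H) + s ^ (2*H) - (t - s) ^ (2*H) = X
    generalize 2 * H - 1 = D at *
    field_simp
  · have h1 : s ^ (2*H) ≥ 0 := Real.rpow_nonneg hs.le _
    have h2 : (t - s) ^ (2*H) ≤ t ^ (2*H) :=
      Real.rpow_le_rpow (by linarith) (by linarith) (by linarith)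
    apply mul_nonneg
    · nlinarith
    · apply div_nonneg
      · linarith
      · nlinarith
  · refine (ae_restrict_iff' measurableSet_Ioc).2 (Filter.Eventually.of_forall ?_)
    intro u hu
    exact mul_nonneg (hZ u t hu.1 (hu.2.trans hst)).1 (hZ u s hu.1 hu.2).1
  · have hm : Measurable (fun u => 
      (ENNReal.ofReal c * ∫⁻ x in Ioo 0 t, gK a u x).toReal *
      (ENNReal.ofReal c * ∫⁻ x in Ioo 0 s, gK a u x).toReal) :=
      ((hmI t).const_mul _).ennreal_toReal.mul ((hmI s).const_mul _).ennreal_toReal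
    refine hm.aestronglyMeasurable.congr ?_
    refine (ae_restrict_iff' measurableSet_Ioc).2 (Filter.Eventually.of_forall ?_)
    intro u hu
    simp only
    rw [hmZ t hst u hu, hmZ s le_rfl u hu]
end

section
/- For every H in (1/2,1), every T > 0, and all functions f, g : [0,T] → ℝ that are finite linear combinations of indicator functions of intervals [0,t_i] with 0 < t_i ≤ T, the transfer operator Γ*_{H,T} is an isometry from the φ-inner product to the L² inner product: ∫₀^T (Γ*_{H,T} f)(u) (Γ*_{H,T} g)(u) du = ∫₀^T ∫₀^T f(s) g(r) H(2H−1)|s−r|^{2H−2} ds dr. -/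
open MeasureTheory Real Set intervalIntegral

/-- The transfer operator `Γ*_{H,T}`:
`(Γ*_{H,T} f)(t) = (H - 1/2) κ_H t^{1/2-H} ∫_t^T u^{H-1/2} (u-t)^{H-3/2} f(u) du`. -/
noncomputable def gammaStar (H T : ℝ) (f : ℝ → ℝ) (t : ℝ) : ℝ :=
  (H - 1/2) * kappaH H * t ^ ((1:ℝ)/2 - H) *
    ∫ u in t..T, u ^ (H - 1/2) * (u - t) ^ (H - 3/2) * f u

/-- `f : [0,T] → ℝ` is a finite linear combination of indicator functions of
intervals `[0, tᵢ]` with `0 < tᵢ ≤ T`. -/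
def IsStepCombination (T : ℝ) (f : ℝ → ℝ) : Prop :=
  ∃ (n : ℕ) (c : Fin n → ℝ) (τ : Fin n → ℝ),
    (∀ i, τ i ∈ Set.Ioc (0:ℝ) T) ∧
    f = fun s => ∑ i, c i * Set.indicator (Set.Icc (0:ℝ) (τ i)) (fun _ => (1:ℝ)) s

/-- The real Beta integral: integrability and value. -/
theorem beta_integral_real {α β : ℝ} (hα : 0 < α) (hβ : 0 < β) :
    IntegrableOn (fun x : ℝ => x ^ (α - 1) * (1 - x) ^ (β - 1)) (Ioo 0 1) ∧
    ∫ x in Ioo (0:ℝ) 1, x ^ (α - 1) * (1 - x) ^ (β - 1) = ProbabilityTheory.beta α β := by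
  have hb := ProbabilityTheory.beta_pos hα hβ
  have h1 := ProbabilityTheory.lintegral_betaPDF_eq_one hα hβ
  rw [ProbabilityTheory.lintegral_betaPDF] at h1
  have hnn : 0 ≤ᵐ[volume.restrict (Ioo (0:ℝ) 1)]
      fun x => 1 / ProbabilityTheory.beta α β * x ^ (α - 1) * (1 - x) ^ (β - 1) := by
    refine ae_restrict_of_forall_mem measurableSet_Ioo fun x hx => ?_
    have h2 : 0 < x := hx.1
    have h3 : 0 < 1 - x := by linarith [hx.2]
    simp only [Pi.zero_apply]
    positivity
  have hm : AEStronglyMeasurable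
      (fun x => 1 / ProbabilityTheory.beta α β * x ^ (α - 1) * (1 - x) ^ (β - 1))
      (volume.restrict (Ioo (0:ℝ) 1)) :=
    Measurable.aestronglyMeasurable (by fun_prop)
  have hint : IntegrableOn
      (fun x => 1 / ProbabilityTheory.beta α β * x ^ (α - 1) * (1 - x) ^ (β - 1)) (Ioo 0 1) := by
    refine (lintegral_ofReal_ne_top_iff_integrable hm hnn).1 ?_
    rw [h1]; simp
  have hval := integral_eq_lintegral_of_nonneg_ae hnn hm
  rw [h1] at hval
  simp_rw [mul_assoc] at hval hint
  constructor
  · have := hint.const_mul (ProbabilityTheory.beta α β)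
    refine this.congr (ae_of_all _ fun x => ?_)
    simp only
    field_simp
  · rw [MeasureTheory.integral_const_mul] at hval
    simp only [ENNReal.toReal_one] at hval
    field_simp at hval
    exact hval

/-- Moebius change of variables in the Beta integral. -/
theorem beta_moebius {a r s : ℝ} (ha : 0 < a) (ha' : a < 1/2) (hr : 0 < r) (hrs : r < s) :
    IntegrableOn (fun t : ℝ => t ^ (-(2*a)) * (s - t) ^ (a - 1) * (r - t) ^ (a - 1)) (Ioo 0 r) ∧
    ∫ t in Ioo (0:ℝ) r, t ^ (-(2*a)) * (s - t) ^ (a - 1) * (r - t) ^ (a - 1) =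
      (s ^ a)⁻¹ * (r ^ a)⁻¹ * (s - r) ^ (2 * a - 1) * ProbabilityTheory.beta (1 - 2*a) a := by
  have hs : 0 < s := hr.trans hrs
  have hsr : 0 < s - r := by linarith
  obtain ⟨hi, hv⟩ := beta_integral_real (α := 1 - 2*a) (β := a) (by linarith) ha
  set m : ℝ → ℝ := fun t => t * (s - r) / (r * (s - t)) with hm
  set m' : ℝ → ℝ := fun t => (s - r) * s / (r * (s - t) ^ 2) with hm'
  have hder : ∀ t ∈ Ioo 0 r, HasDerivWithinAt m (m' t) (Ioo 0 r) t := by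
    intro t ht
    have hst : 0 < s - t := by linarith [ht.2]
    have h1 : HasDerivAt (fun t : ℝ => t * (s - r)) (1 * (s - r)) t :=
      (hasDerivAt_id t).mul_const _
    have h2 : HasDerivAt (fun t : ℝ => r * (s - t)) (r * (-1)) t :=
      ((hasDerivAt_id t).const_sub s).const_mul r
    have h3 := h1.div h2 (by positivity)
    refine HasDerivAt.hasDerivWithinAt (h3.congr_deriv ?_)
    simp only [hm']
    field_simp
    ring
  have hinj : InjOn m (Ioo 0 r) := by
    intro t ht u hu h
    have hst : 0 < s - t := by linarith [ht.2]
    have hsu : 0 < s - u := by linarith [hu.2]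
    simp only [hm] at h
    rw [div_eq_div_iff (by positivity) (by positivity)] at h
    have : (t - u) * ((s - r) * r * s) = 0 := by linear_combination h
    have h0 : (s - r) * r * s ≠ 0 := by positivity
    rcases mul_eq_zero.1 this with h | h
    · linarith
    · exact absurd h h0
  have himg : Set.image m (Ioo 0 r) = Ioo 0 1 := by
    ext x
    constructor
    · rintro ⟨t, ht, rfl⟩
      have h0 := ht.1
      have hst : 0 < s - t := by linarith [ht.2]
      refine ⟨by simp only [hm]; positivity, ?_⟩
      simp only [hm]
      rw [div_lt_one (by positivity)]
      nlinarith [mul_pos hs (sub_pos.2 ht.2)]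
    · rintro ⟨hx0, hx1⟩
      have hd : 0 < s - r + x * r := by positivity
      refine ⟨x * r * s / (s - r + x * r), ⟨by positivity, ?_⟩, ?_⟩
      · rw [div_lt_iff₀ hd]
        nlinarith [mul_pos (mul_pos hr hsr) (sub_pos.2 hx1)]
      · simp only [hm]
        have : s - x * r * s / (s - r + x * r) = s * (s - r) / (s - r + x * r) := by
          field_simp; ring
        rw [this]
        field_simp
  have hpt : ∀ t ∈ Ioo 0 r, |m' t| • ((m t) ^ ((1 - 2*a) - 1) * (1 - m t) ^ (a - 1)) =
      (s ^ a * r ^ a * (s - r) ^ (1 - 2 * a)) *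
        (t ^ (-(2*a)) * (s - t) ^ (a - 1) * (r - t) ^ (a - 1)) := by
    intro t ht
    have h0 := ht.1
    have hst : 0 < s - t := by linarith [ht.2]
    have hrt : 0 < r - t := by linarith [ht.2]
    have h1m : 1 - m t = s * (r - t) / (r * (s - t)) := by
      simp only [hm]; field_simp; ring
    have hm'pos : 0 < m' t := by simp only [hm']; positivity
    rw [abs_of_pos hm'pos, h1m, smul_eq_mul]
    simp only [hm, hm']
    have e : (1 - 2*a) - 1 = -(2*a) := by ring
    rw [e]
    have key : ∀ x : ℝ, 0 < x → ∀ p : ℝ, x ^ p = Real.exp (Real.log x * p) :=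
      fun x hx p => Real.rpow_def_of_pos hx p
    have pm : ∀ x : ℝ, 0 < x → x ^ (a - 1) = x ^ a / x := fun x hx => by
      rw [Real.rpow_sub hx, Real.rpow_one]
    have pn : ∀ x : ℝ, 0 < x → x ^ (-(2*a)) = (x ^ a)⁻¹ ^ 2 := fun x hx => by
      rw [Real.rpow_neg hx.le, two_mul, Real.rpow_add hx, inv_pow, pow_two]
    have pq : (s - r) ^ (1 - 2*a) = (s - r) * ((s - r) ^ a)⁻¹ ^ 2 := by
      rw [sub_eq_add_neg 1, Real.rpow_add hsr, Real.rpow_one, pn _ hsr]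
    rw [pm _ (by positivity), pn _ (by positivity), pq, pm _ hst, pm _ hrt, pn _ h0,
      Real.div_rpow (by positivity) (by positivity), Real.div_rpow (by positivity) (by positivity),
      Real.mul_rpow h0.le hsr.le, Real.mul_rpow hr.le hst.le, Real.mul_rpow hs.le hrt.le]
    have p1 := Real.rpow_pos_of_pos h0 a
    have p2 := Real.rpow_pos_of_pos hsr a
    have p3 := Real.rpow_pos_of_pos hr a
    have p4 := Real.rpow_pos_of_pos hst a
    have p5 := Real.rpow_pos_of_pos hs a
    have p6 := Real.rpow_pos_of_pos hrt a
    field_simp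
  have hC : 0 < s ^ a * r ^ a * (s - r) ^ (1 - 2 * a) := by positivity
  have hI := (integrableOn_image_iff_integrableOn_abs_deriv_smul measurableSet_Ioo hder hinj
    (fun x : ℝ => x ^ ((1 - 2*a) - 1) * (1 - x) ^ (a - 1)))
  have hV := (integral_image_eq_integral_abs_deriv_smul measurableSet_Ioo hder hinj
    (fun x : ℝ => x ^ ((1 - 2*a) - 1) * (1 - x) ^ (a - 1)))
  rw [himg] at hI hV
  have hI2 := (integrableOn_congr_fun hpt measurableSet_Ioo).1 (hI.1 hi)
  rw [setIntegral_congr_fun measurableSet_Ioo hpt, MeasureTheory.integral_const_mul, hv] at hV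
  constructor
  · refine (hI2.const_mul (s ^ a * r ^ a * (s - r) ^ (1 - 2 * a))⁻¹).congr (ae_of_all _ fun x => ?_)
    simp only
    rw [inv_mul_cancel_left₀ hC.ne']
  · rw [hV]
    have e : 2 * a - 1 = -(1 - 2 * a) := by ring
    rw [e, Real.rpow_neg hsr.le]
    have p2 := Real.rpow_pos_of_pos hsr (1 - 2*a)
    field_simp

/-- The kernel of the transfer operator, without its constant. -/
noncomputable def kerH (H t u : ℝ) : ℝ :=
  if t < u then t ^ ((1:ℝ)/2 - H) * (u ^ (H - 1/2) * (u - t) ^ (H - 3/2)) else 0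

theorem measurable_kerH (H : ℝ) : Measurable (fun p : ℝ × ℝ => kerH H p.1 p.2) := by
  unfold kerH
  exact Measurable.ite (measurableSet_lt measurable_fst measurable_snd) (by fun_prop) (by fun_prop)

theorem kerH_nonneg {H t u : ℝ} (ht : 0 < t) : 0 ≤ kerH H t u := by
  unfold kerH
  split_ifs with h
  · have h1 : 0 < u := ht.trans h
    have h2 : 0 < u - t := by linarith
    positivity
  · exact le_rfl

theorem kerH_integral_aux {H T r s : ℝ} (hH : H ∈ Set.Ioo (1/2 : ℝ) 1) (hr : 0 < r) (hrs : r < s)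
    (hsT : s ≤ T) :
    IntegrableOn (fun t => kerH H t s * kerH H t r) (Ioc 0 T) ∧
    ∫ t in Ioc 0 T, kerH H t s * kerH H t r =
      ProbabilityTheory.beta (2 - 2*H) (H - 1/2) * |s - r| ^ (2*H - 2) := by
  obtain ⟨h1, h2⟩ := hH
  have hs : 0 < s := hr.trans hrs
  have hsr : 0 < s - r := by linarith
  obtain ⟨hi, hv⟩ := beta_moebius (a := H - 1/2) (by linarith) (by linarith) hr hrs
  have hzero : ∀ t ∈ Ioc 0 T \ Ioo 0 r, kerH H t s * kerH H t r = 0 := by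
    intro t ht
    have : ¬ t < r := fun h => ht.2 ⟨ht.1.1, h⟩
    simp [kerH, this]
  have hsub : Ioo 0 r ⊆ Ioc 0 T := fun t ht => ⟨ht.1, by linarith [ht.2]⟩
  have hpt : ∀ t ∈ Ioo 0 r, kerH H t s * kerH H t r =
      (s ^ (H - 1/2) * r ^ (H - 1/2)) * (t ^ (-(2*(H - 1/2))) * (s - t) ^ ((H - 1/2) - 1)
        * (r - t) ^ ((H - 1/2) - 1)) := by
    intro t ht
    have e1 : t ^ (-(2*(H - 1/2))) = t ^ ((1:ℝ)/2 - H) * t ^ ((1:ℝ)/2 - H) := by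
      rw [← Real.rpow_add ht.1]; congr 1; ring
    have e2 : (H - 1/2) - 1 = H - 3/2 := by ring
    rw [e1, e2]
    simp only [kerH, if_pos ht.2, if_pos (ht.2.trans hrs)]
    ring
  have hiO : IntegrableOn (fun t => kerH H t s * kerH H t r) (Ioo 0 r) :=
    (integrableOn_congr_fun hpt measurableSet_Ioo).2 (hi.const_mul _)
  constructor
  · exact hiO.of_forall_sdiff_eq_zero measurableSet_Ioc hzero
  · rw [setIntegral_eq_of_subset_of_forall_sdiff_eq_zero measurableSet_Ioc hsub hzero,
      setIntegral_congr_fun measurableSet_Ioo hpt, MeasureTheory.integral_const_mul, hv,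
      abs_of_pos hsr]
    have e3 : 2 * (H - 1/2) - 1 = 2 * H - 2 := by ring
    have e4 : 1 - 2 * (H - 1/2) = 2 - 2 * H := by ring
    rw [e3, e4]
    have p1 := Real.rpow_pos_of_pos hs (H - 1/2)
    have p2 := Real.rpow_pos_of_pos hr (H - 1/2)
    field_simp

theorem kerH_integral {H T r s : ℝ} (hH : H ∈ Set.Ioo (1/2 : ℝ) 1) (hs : s ∈ Ioc 0 T)
    (hr : r ∈ Ioc 0 T) (hne : s ≠ r) :
    IntegrableOn (fun t => kerH H t s * kerH H t r) (Ioc 0 T) ∧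
    ∫ t in Ioc 0 T, kerH H t s * kerH H t r =
      ProbabilityTheory.beta (2 - 2*H) (H - 1/2) * |s - r| ^ (2*H - 2) := by
  rcases lt_or_gt_of_ne hne with h | h
  · have := kerH_integral_aux hH hs.1 h hr.2
    simp_rw [mul_comm (kerH H _ r), abs_sub_comm r s] at this
    exact this
  · exact kerH_integral_aux hH hr.1 h hs.2

theorem const_identity {H : ℝ} (hH : H ∈ Set.Ioo (1/2 : ℝ) 1) :
    ((H - 1/2) * kappaH H) ^ 2 * ProbabilityTheory.beta (2 - 2*H) (H - 1/2) = H * (2*H - 1) := by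
  obtain ⟨h1, h2⟩ := hH
  have g1 : 0 < Real.Gamma (3/2 - H) := Real.Gamma_pos_of_pos (by linarith)
  have g2 : 0 < Real.Gamma (H - 1/2) := Real.Gamma_pos_of_pos (by linarith)
  have g3 : 0 < Real.Gamma (2 - 2*H) := Real.Gamma_pos_of_pos (by linarith)
  have g4 : Real.Gamma (H + 1/2) = (H - 1/2) * Real.Gamma (H - 1/2) := by
    rw [← Real.Gamma_add_one (by linarith)]; congr 1; ring
  have h3 : 0 < H - 1/2 := by linarith
  have h4 : 0 < H := by linarith
  have e : 2 - 2*H + (H - 1/2) = 3/2 - H := by ring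
  rw [mul_pow, kappaH, g4, Real.sq_sqrt (by positivity), ProbabilityTheory.beta, e]
  generalize hx : H - 1/2 = x at *
  have hx2 : 2 * H - 1 = 2 * x := by rw [← hx]; ring
  rw [hx2]
  generalize Real.Gamma (3/2 - H) = G at *
  field_simp

theorem phi_integrable {H T : ℝ} (hH : H ∈ Set.Ioo (1/2 : ℝ) 1) :
    Integrable (fun p : ℝ × ℝ => |p.1 - p.2| ^ (2*H - 2))
      ((volume.restrict (Ioc 0 T)).prod (volume.restrict (Ioc 0 T))) := by
  obtain ⟨h1, h2⟩ := hH
  have hg : Integrable ((Icc (-T) T).indicator fun x : ℝ => |x| ^ (2*H - 2)) := by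
    rw [integrable_indicator_iff measurableSet_Icc]
    rcases lt_or_ge T 0 with hT | hT
    · rw [Icc_eq_empty (by linarith)]; exact integrableOn_empty
    have hp : IntegrableOn (fun x : ℝ => |x| ^ (2*H - 2)) (Icc 0 T) := by
      have := intervalIntegral.intervalIntegrable_rpow' (a := 0) (b := T) (r := 2*H - 2)
        (by linarith)
      rw [intervalIntegrable_iff_integrableOn_Icc_of_le hT] at this
      exact (integrableOn_congr_fun (fun x hx => by simp only [abs_of_nonneg hx.1])
        measurableSet_Icc).1 this
    have hn : IntegrableOn (fun x : ℝ => |x| ^ (2*H - 2)) (Icc (-T) 0) := by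
      have := hp.comp_neg
      simpa using this
    have := hn.union hp
    rwa [Icc_union_Icc_eq_Icc (by linarith) hT] at this
  have hf : Integrable ((Ioc 0 T).indicator fun _ : ℝ => (1:ℝ)) := by
    rw [integrable_indicator_iff measurableSet_Ioc]
    exact integrableOn_const (by simp)
  have hc := hf.convolution_integrand (ContinuousLinearMap.mul ℝ ℝ) hg
  rw [Measure.prod_restrict]
  have hc2 : IntegrableOn _ (Ioc 0 T ×ˢ Ioc 0 T) (volume.prod volume) := hc.integrableOn
  refine (integrableOn_congr_fun ?_ (measurableSet_Ioc.prod measurableSet_Ioc)).1 hc2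
  rintro ⟨x, y⟩ ⟨hx, hy⟩
  simp only [mem_Ioc] at hx hy
  have h : x - y ∈ Icc (-T) T := ⟨by linarith, by linarith⟩
  have h' : y ∈ Ioc 0 T := hy
  simp [indicator_of_mem h, indicator_of_mem h']

theorem gammaStar_eq {H T t : ℝ} (f : ℝ → ℝ) (ht : t ∈ Ioc 0 T) :
    gammaStar H T f t = ((H - 1/2) * kappaH H) * ∫ u in Ioc 0 T, kerH H t u * f u := by
  have hsub : Ioc t T ⊆ Ioc 0 T := fun u hu => ⟨ht.1.trans hu.1, hu.2⟩
  rw [gammaStar, intervalIntegral.integral_of_le ht.2, mul_assoc,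
    setIntegral_eq_of_subset_of_forall_sdiff_eq_zero (s := Ioc t T) measurableSet_Ioc hsub,
    ← MeasureTheory.integral_const_mul]
  · congr 1
    refine setIntegral_congr_fun measurableSet_Ioc fun u hu => ?_
    simp only [kerH, if_pos hu.1]
    ring
  · intro u hu
    have : ¬ t < u := fun h => hu.2 ⟨h, hu.1.2⟩
    simp [kerH, this]

theorem step_measurable {T : ℝ} {f : ℝ → ℝ} (hf : IsStepCombination T f) :
    Measurable f ∧ ∃ C, ∀ x, |f x| ≤ C := by
  obtain ⟨n, c, τ, -, rfl⟩ := hf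
  refine ⟨?_, ∑ i, |c i|, fun x => ?_⟩
  · refine Finset.measurable_sum _ fun i _ => ?_
    exact (measurable_const.indicator measurableSet_Icc).const_mul _
  · refine (Finset.abs_sum_le_sum_abs _ _).trans (Finset.sum_le_sum fun i _ => ?_)
    rw [abs_mul]
    refine mul_le_of_le_one_right (abs_nonneg _) ?_
    unfold Set.indicator
    split_ifs <;> simp

theorem isometry_aux {H T : ℝ} (hH : H ∈ Set.Ioo (1/2 : ℝ) 1) {f g : ℝ → ℝ}
    (hf : Measurable f) (hg : Measurable g) {A B : ℝ} (hA : ∀ x, |f x| ≤ A)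
    (hB : ∀ x, |g x| ≤ B) :
    ∫ t in Ioc 0 T, (∫ u in Ioc 0 T, kerH H t u * f u) * (∫ u in Ioc 0 T, kerH H t u * g u) =
    ∫ s in Ioc 0 T, ∫ r in Ioc 0 T,
      f s * g r * (ProbabilityTheory.beta (2 - 2*H) (H - 1/2) * |s - r| ^ (2*H - 2)) := by
  set μ := volume.restrict (Ioc (0:ℝ) T) with hμ
  set b := ProbabilityTheory.beta (2 - 2*H) (H - 1/2) with hb
  have hbpos : 0 < b := ProbabilityTheory.beta_pos (by linarith [hH.2]) (by linarith [hH.1])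
  have hphi := phi_integrable (T := T) hH
  rw [← hμ] at hphi
  have hfg : Measurable (fun p : ℝ × ℝ => f p.1 * g p.2) := by fun_prop
  have hfgb : ∀ p : ℝ × ℝ, ‖f p.1 * g p.2‖ ≤ A * B := fun p => by
    rw [Real.norm_eq_abs, abs_mul]
    exact mul_le_mul (hA _) (hB _) (abs_nonneg _) ((abs_nonneg _).trans (hA p.1))
  have hR : Integrable (fun p : ℝ × ℝ => f p.1 * g p.2 * (b * |p.1 - p.2| ^ (2*H - 2)))
      (μ.prod μ) :=
    (hphi.const_mul b).bdd_mul hfg.aestronglyMeasurable (ae_of_all _ hfgb)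
  -- almost every pair is off the diagonal and in the square
  have hae : ∀ᵐ p : ℝ × ℝ ∂(μ.prod μ), p.1 ∈ Ioc 0 T ∧ p.2 ∈ Ioc 0 T ∧ p.1 ≠ p.2 := by
    have hmeas : MeasurableSet {p : ℝ × ℝ | p.1 ∈ Ioc 0 T ∧ p.2 ∈ Ioc 0 T ∧ p.1 ≠ p.2} := by
      refine (measurable_fst measurableSet_Ioc).inter
        ((measurable_snd measurableSet_Ioc).inter ?_)
      exact (measurableSet_eq_fun measurable_fst measurable_snd).compl
    rw [Measure.ae_prod_iff_ae_ae hmeas]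
    filter_upwards [ae_restrict_mem (measurableSet_Ioc (a := (0:ℝ)) (b := T))] with s hs
    have hne : ∀ᵐ r ∂μ, r ≠ s := ae_restrict_of_ae (Measure.ae_ne volume s)
    filter_upwards [ae_restrict_mem (measurableSet_Ioc (a := (0:ℝ)) (b := T)), hne] with r hr h
    exact ⟨hs, hr, fun e => h e.symm⟩
  set F : ℝ → ℝ × ℝ → ℝ := fun t p => (kerH H t p.1 * f p.1) * (kerH H t p.2 * g p.2) with hF
  have hFeq : ∀ t p, F t p = (f p.1 * g p.2) * (kerH H t p.1 * kerH H t p.2) := by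
    intro t p; simp only [hF]; ring
  have hFm : Measurable (Function.uncurry F) := by
    have k := measurable_kerH H
    have k1 : Measurable (fun q : ℝ × (ℝ × ℝ) => kerH H q.1 q.2.1) :=
      k.comp (by fun_prop : Measurable (fun q : ℝ × (ℝ × ℝ) => (q.1, q.2.1)))
    have k2 : Measurable (fun q : ℝ × (ℝ × ℝ) => kerH H q.1 q.2.2) :=
      k.comp (by fun_prop : Measurable (fun q : ℝ × (ℝ × ℝ) => (q.1, q.2.2)))
    exact (k1.mul (by fun_prop)).mul (k2.mul (by fun_prop))
  have hFint : Integrable (Function.uncurry F) (μ.prod (μ.prod μ)) := by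
    rw [integrable_prod_iff' hFm.aestronglyMeasurable]
    constructor
    · filter_upwards [hae] with p hp
      simp only [Function.uncurry, hFeq]
      exact ((kerH_integral hH hp.1 hp.2.1 hp.2.2).1).const_mul _
    · refine hR.norm.congr ?_
      filter_upwards [hae] with p hp
      have h1 : ∫ t, ‖F t p‖ ∂μ = ∫ t, ‖f p.1 * g p.2‖ * (kerH H t p.1 * kerH H t p.2) ∂μ := by
        refine setIntegral_congr_fun measurableSet_Ioc fun t ht => ?_
        simp only [hFeq]
        rw [norm_mul, Real.norm_of_nonneg (mul_nonneg (kerH_nonneg ht.1) (kerH_nonneg ht.1))]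
      simp only [Function.uncurry]
      rw [h1, MeasureTheory.integral_const_mul, (kerH_integral hH hp.1 hp.2.1 hp.2.2).2, norm_mul,
        Real.norm_of_nonneg (r := b * _ ^ _) (by positivity)]
  have hswap := integral_integral_swap hFint
  have hL : ∀ t, ∫ p, F t p ∂(μ.prod μ) =
      (∫ u, kerH H t u * f u ∂μ) * (∫ u, kerH H t u * g u ∂μ) := fun t =>
    integral_prod_mul (fun u => kerH H t u * f u) (fun u => kerH H t u * g u)
  simp_rw [hL] at hswap
  rw [hswap, ← integral_prod _ hR]
  refine integral_congr_ae ?_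
  filter_upwards [hae] with p hp
  simp only [hFeq]
  rw [MeasureTheory.integral_const_mul, (kerH_integral hH hp.1 hp.2.1 hp.2.2).2]

/-- For `1/2 < H < 1`, `T > 0` and `f, g` finite linear combinations of indicators of
intervals `[0,tᵢ] ⊆ [0,T]`, the transfer operator `Γ*_{H,T}` is an isometry from the
`φ`-inner product to the `L²` inner product:
`∫₀^T (Γ*_{H,T} f)(u) (Γ*_{H,T} g)(u) du
  = ∫₀^T ∫₀^T f(s) g(r) H(2H-1)|s-r|^{2H-2} ds dr`. -/
theorem gammaStar_isometry (H : ℝ) (hH : H ∈ Set.Ioo (1/2 : ℝ) 1)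
    (T : ℝ) (hT : 0 < T) (f g : ℝ → ℝ)
    (hf : IsStepCombination T f) (hg : IsStepCombination T g) :
    ∫ u in (0:ℝ)..T, gammaStar H T f u * gammaStar H T g u
      = ∫ s in (0:ℝ)..T, ∫ r in (0:ℝ)..T,
          f s * g r * (H * (2*H - 1) * |s - r| ^ (2*H - 2)) := by
  obtain ⟨hfm, A, hA⟩ := step_measurable hf
  obtain ⟨hgm, B, hB⟩ := step_measurable hg
  have hmain := isometry_aux (T := T) hH hfm hgm hA hB
  have hc := const_identity hH
  simp only [intervalIntegral.integral_of_le hT.le]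
  have h1 : ∫ u in Ioc 0 T, gammaStar H T f u * gammaStar H T g u =
      ((H - 1/2) * kappaH H) ^ 2 * ∫ t in Ioc 0 T,
        (∫ u in Ioc 0 T, kerH H t u * f u) * (∫ u in Ioc 0 T, kerH H t u * g u) := by
    rw [← MeasureTheory.integral_const_mul]
    refine setIntegral_congr_fun measurableSet_Ioc fun t ht => ?_
    simp only [gammaStar_eq _ ht]
    ring
  rw [h1, hmain, ← MeasureTheory.integral_const_mul]
  refine MeasureTheory.integral_congr_ae (ae_of_all _ fun s => ?_)
  simp only
  rw [← MeasureTheory.integral_const_mul]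
  refine MeasureTheory.integral_congr_ae (ae_of_all _ fun r => ?_)
  simp only
  rw [← hc]
  ring
end
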